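/- Let g be a C^∞ function on Δ with everywhere positive definite Hessian satisfying g(x) = log det(½∇²g(x)) for all x ∈ Δ and g(x) → +∞ as x approaches any boundary point of Δ. Then the gradient map ∇g : Δ → ℝ^d is a diffeomorphism: it is injective, surjective onto all of ℝ^d, and (since its differential ∇²g(x) is invertible at every point) smooth with smooth inverse. -/

import Mathlib

open Real Filter MeasureTheory
open scoped Matrix

noncomputable section

/-- The open subprobability simplex in `ℝ^d`. -/
def simplexΔ (d : ℕ) : Set (Fin d → ℝ) := {x | (∀ i, 0 < x i) ∧ ∑ i, x i < 1}

/-- Hessian matrix of `u` at `x` (entries `∂²u/∂xᵢ∂xⱼ`). -/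
def hess (d : ℕ) (u : (Fin d → ℝ) → ℝ) (x : Fin d → ℝ) : Matrix (Fin d) (Fin d) ℝ :=
  Matrix.of fun i j => fderiv ℝ (fun y => fderiv ℝ u y (Pi.single j 1)) x (Pi.single i 1)

/-- The barrier function `w(x) = -2∑ log xᵢ - 2 log(1-∑xᵢ)`. -/
def wbar (d : ℕ) (x : Fin d → ℝ) : ℝ :=
  -2 * ∑ i, Real.log (x i) - 2 * Real.log (1 - ∑ i, x i)

/-- Gradient of `u` at `x`. -/
def gradv (d : ℕ) (u : (Fin d → ℝ) → ℝ) (x : Fin d → ℝ) : Fin d → ℝ :=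
  fun i => fderiv ℝ u x (Pi.single i 1)

theorem isOpen_simplexΔ (d : ℕ) : IsOpen (simplexΔ d) := by
  have h : simplexΔ d = (⋂ i, {x | 0 < x i}) ∩ {x | ∑ i, x i < 1} := by
    ext x; simp [simplexΔ]
  rw [h]
  exact (isOpen_iInter_of_finite fun i => isOpen_lt continuous_const (continuous_apply i)).inter
    (isOpen_lt (by fun_prop) continuous_const)

theorem convex_simplexΔ (d : ℕ) : Convex ℝ (simplexΔ d) := by
  have h : simplexΔ d = (⋂ i, {x | 0 < x i}) ∩ {x | ∑ i, x i < 1} := by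
    ext x; simp [simplexΔ]
  rw [h]
  refine (convex_iInter fun i => convex_halfSpace_gt (IsLinearMap.mk (by simp) (by simp)) 0).inter
    (convex_halfSpace_lt (IsLinearMap.mk ?_ ?_) 1)
  · simp [Finset.sum_add_distrib]
  · simp [Finset.mul_sum]

theorem nonempty_simplexΔ (d : ℕ) : (simplexΔ d).Nonempty := by
  refine ⟨fun _ => 1 / ((d : ℝ) + 1), fun _ => by positivity, ?_⟩
  have : (0 : ℝ) < d + 1 := by positivity
  simp only [Finset.sum_const, Finset.card_univ, Fintype.card_fin, nsmul_eq_mul]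
  rw [mul_one_div, div_lt_one this]
  linarith

theorem isBounded_simplexΔ (d : ℕ) : Bornology.IsBounded (simplexΔ d) := by
  refine (Metric.isBounded_Icc (0 : Fin d → ℝ) 1).subset fun x hx => ⟨fun i => (hx.1 i).le, ?_⟩
  intro i
  exact (Finset.single_le_sum (fun j _ => (hx.1 j).le) (Finset.mem_univ i)).trans hx.2.le

/-- A continuous function on a nonempty bounded open set which blows up at the boundary attains
its minimum. -/
theorem exists_isMinOn_of_tendsto_frontier {E : Type*} [PseudoMetricSpace E] [ProperSpace E]
    {s : Set E} (hs : IsOpen s) (hne : s.Nonempty) (hb : Bornology.IsBounded s) {f : E → ℝ}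
    (hf : ContinuousOn f s) (hbd : ∀ x ∈ frontier s, Tendsto f (nhdsWithin x s) atTop) :
    ∃ x ∈ s, IsMinOn f s x := by
  obtain ⟨x₀, hx₀⟩ := hne
  set K : Set E := {x ∈ s | f x ≤ f x₀}
  have hK : IsCompact K := by
    refine Metric.isCompact_of_isClosed_isBounded (isClosed_of_closure_subset fun z hz => ?_)
      (hb.subset fun x hx => hx.1)
    have hfreq : ∃ᶠ x in nhdsWithin z s, f x ≤ f x₀ := by
      rw [frequently_nhdsWithin_iff]
      exact (mem_closure_iff_frequently.1 hz).mono fun x hx => ⟨hx.2, hx.1⟩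
    by_cases hzs : z ∈ s
    · refine ⟨hzs, le_of_not_gt fun hlt => ?_⟩
      obtain ⟨x, hx, hx'⟩ :=
        (hfreq.and_eventually ((hf z hzs).eventually (lt_mem_nhds hlt))).exists
      exact absurd hx' hx.not_gt
    · have hzf : z ∈ frontier s := by
        rw [hs.frontier_eq]
        exact ⟨closure_mono (fun x hx => hx.1) hz, hzs⟩
      obtain ⟨x, hx, hx'⟩ :=
        (hfreq.and_eventually ((hbd z hzf).eventually_gt_atTop (f x₀))).exists
      exact absurd hx' hx.not_gt
  obtain ⟨x, hx, hmin⟩ :=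
    hK.exists_isMinOn ⟨x₀, hx₀, le_rfl⟩ (hf.mono fun x hx => hx.1)
  refine ⟨x, hx.1, fun y hy => ?_⟩
  rcases le_total (f y) (f x₀) with h | h
  · exact hmin ⟨hy, h⟩
  · exact hx.2.trans h

/-- A map with positive definite differential on a convex open set is injective. -/
theorem injOn_of_fderiv_pos {ι : Type*} [Fintype ι] {s : Set (ι → ℝ)} (hs : IsOpen s)
    (hc : Convex ℝ s) {F : (ι → ℝ) → ι → ℝ} (hF : DifferentiableOn ℝ F s)
    (hpos : ∀ x ∈ s, ∀ v ≠ 0, 0 < fderiv ℝ F x v ⬝ᵥ v) : Set.InjOn F s := by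
  intro x hx y hy hxy
  by_contra hne
  have hv : y - x ≠ 0 := sub_ne_zero.2 (Ne.symm hne)
  have hmem : ∀ t ∈ Set.Icc (0 : ℝ) 1, x + t • (y - x) ∈ s := fun t ht =>
    hc.add_smul_sub_mem hx hy ht
  have hder : ∀ t ∈ Set.Icc (0 : ℝ) 1,
      HasDerivAt (fun t : ℝ => F (x + t • (y - x)) ⬝ᵥ (y - x))
        (fderiv ℝ F (x + t • (y - x)) (y - x) ⬝ᵥ (y - x)) t := by
    intro t ht
    have hline : HasDerivAt (fun t : ℝ => x + t • (y - x)) (y - x) t := by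
      simpa using ((hasDerivAt_id t).smul_const (y - x)).const_add x
    have hcomp :=
      ((hF.differentiableAt (hs.mem_nhds (hmem t ht))).hasFDerivAt).comp_hasDerivAt t hline
    exact HasDerivAt.fun_sum fun i _ => ((hasDerivAt_pi.1 hcomp) i).mul_const _
  have hmono := strictMonoOn_of_deriv_pos (convex_Icc (0 : ℝ) 1)
    (fun t ht => (hder t ht).continuousAt.continuousWithinAt) fun t ht => by
      rw [(hder t (interior_subset ht)).deriv]
      exact hpos _ (hmem t (interior_subset ht)) _ hv
  have := hmono (Set.left_mem_Icc.2 zero_le_one) (Set.right_mem_Icc.2 zero_le_one) zero_lt_one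
  simp [hxy] at this

theorem contDiffOn_gradv {d : ℕ} {g : (Fin d → ℝ) → ℝ} {s : Set (Fin d → ℝ)} (hs : IsOpen s)
    (hg : ContDiffOn ℝ (⊤ : ℕ∞) g s) : ContDiffOn ℝ (⊤ : ℕ∞) (gradv d g) s :=
  contDiffOn_pi.2 fun _ => (hg.fderiv_of_isOpen hs (by simp)).clm_apply contDiffOn_const

theorem fderiv_gradv_apply {d : ℕ} {g : (Fin d → ℝ) → ℝ} {x : Fin d → ℝ}
    (hg : DifferentiableAt ℝ (gradv d g) x) (v : Fin d → ℝ) :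
    fderiv ℝ (gradv d g) x v = v ᵥ* hess d g x := by
  ext j
  have hij : ∀ i, hess d g x i j = fderiv ℝ (gradv d g) x (Pi.single i 1) j := fun i => by
    change fderiv ℝ (fun y => gradv d g y j) x (Pi.single i 1) = _
    rw [fderiv_apply hg]
    rfl
  conv_lhs => rw [pi_eq_sum_univ' v]
  simp [Matrix.vecMul, dotProduct, hij]

theorem fderiv_gradv_pos {d : ℕ} {g : (Fin d → ℝ) → ℝ} {x : Fin d → ℝ}
    (hg : DifferentiableAt ℝ (gradv d g) x) (hpos : (hess d g x).PosDef) {v : Fin d → ℝ}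
    (hv : v ≠ 0) : 0 < fderiv ℝ (gradv d g) x v ⬝ᵥ v := by
  rw [fderiv_gradv_apply hg, ← Matrix.dotProduct_mulVec]
  simpa using hpos.dotProduct_mulVec_pos hv

/-- If `g` blows up at the boundary of a bounded open set, its gradient takes every value. -/
theorem exists_gradv_eq {d : ℕ} {g : (Fin d → ℝ) → ℝ} {s : Set (Fin d → ℝ)} (hs : IsOpen s)
    (hne : s.Nonempty) (hb : Bornology.IsBounded s) (hg : DifferentiableOn ℝ g s)
    (hbd : ∀ x ∈ frontier s, Tendsto g (nhdsWithin x s) atTop) (y : Fin d → ℝ) :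
    ∃ x ∈ s, gradv d g x = y := by
  let L : (Fin d → ℝ) →L[ℝ] ℝ := ∑ i, y i • ContinuousLinearMap.proj i
  obtain ⟨x, hx, hmin⟩ := exists_isMinOn_of_tendsto_frontier (f := fun x => g x + -L x) hs hne hb
    (hg.continuousOn.add L.continuous.neg.continuousOn)
    fun z hz => (hbd z hz).atTop_add (L.continuous.neg.continuousAt.mono_left nhdsWithin_le_nhds)
  have h0 := (hmin.isLocalMin (hs.mem_nhds hx)).hasFDerivAt_eq_zero
    ((hg.differentiableAt (hs.mem_nhds hx)).hasFDerivAt.add L.hasFDerivAt.neg)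
  refine ⟨x, hx, funext fun i => ?_⟩
  have hi := congrArg (fun l : (Fin d → ℝ) →L[ℝ] ℝ => l (Pi.single i 1)) h0
  simp only [L, add_apply, neg_apply, sum_apply, smul_apply,
    ContinuousLinearMap.proj_apply, Pi.single_apply, smul_eq_mul, mul_ite, mul_one, mul_zero,
    Finset.sum_ite_eq', Finset.mem_univ, if_true, zero_apply] at hi
  exact add_neg_eq_zero.1 hi

/-- A global inverse of an injective smooth map is smooth wherever the differential is
injective. -/
theorem contDiffAt_of_leftInvOn {E : Type*} [NormedAddCommGroup E] [NormedSpace ℝ E]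
    [FiniteDimensional ℝ E] {s : Set E} (hs : IsOpen s) {F H : E → E} {n : WithTop ℕ∞}
    (hn : n ≠ 0) {x : E} (hx : x ∈ s) (hF : ContDiffAt ℝ n F x)
    (hinj : Function.Injective (fderiv ℝ F x)) (hH : Set.LeftInvOn H F s) :
    ContDiffAt ℝ n H (F x) := by
  have := FiniteDimensional.complete ℝ E
  let e : E ≃L[ℝ] E :=
    (LinearEquiv.ofInjectiveEndo (fderiv ℝ F x : E →ₗ[ℝ] E) hinj).toContinuousLinearEquiv
  have hF' : HasFDerivAt F (e : E →L[ℝ] E) x := (hF.differentiableAt hn).hasFDerivAt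
  have hloc := hF.to_localInverse hF' hn
  refine hloc.congr_of_eventuallyEq ?_
  have hcont := hloc.continuousAt
  rw [ContinuousAt, hF.localInverse_apply_image hF' hn] at hcont
  filter_upwards [hcont (hs.mem_nhds hx),
    (hF.hasStrictFDerivAt' hF' hn).eventually_right_inverse] with z hz hz'
  have h := hH hz
  exact (congrArg H hz').symm.trans h

/-- The gradient map of the Monge–Ampère solution is a diffeomorphism from the
simplex onto `ℝ^d`. -/
theorem grad_is_diffeomorphism (d : ℕ) (hd : 1 ≤ d) (g : (Fin d → ℝ) → ℝ)
    (hg : ContDiffOn ℝ (⊤ : ℕ∞) g (simplexΔ d))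
    (hpos : ∀ x ∈ simplexΔ d, (hess d g x).PosDef)
    (hMA : ∀ x ∈ simplexΔ d, g x = Real.log (((2 : ℝ)⁻¹ • hess d g x).det))
    (hbd : ∀ x0 ∈ frontier (simplexΔ d),
      Filter.Tendsto g (nhdsWithin x0 (simplexΔ d)) Filter.atTop) :
    Set.InjOn (gradv d g) (simplexΔ d) ∧
    gradv d g '' simplexΔ d = Set.univ ∧
    ContDiffOn ℝ (⊤ : ℕ∞) (gradv d g) (simplexΔ d) ∧
    ∃ H : (Fin d → ℝ) → (Fin d → ℝ),
      ContDiff ℝ (⊤ : ℕ∞) H ∧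
      (∀ x ∈ simplexΔ d, H (gradv d g x) = x) ∧
      (∀ y : Fin d → ℝ, H y ∈ simplexΔ d ∧ gradv d g (H y) = y) := by
  have hs := isOpen_simplexΔ d
  have hsmooth := contDiffOn_gradv hs hg
  have hdiff : DifferentiableOn ℝ (gradv d g) (simplexΔ d) := hsmooth.differentiableOn (by simp)
  have hder : ∀ x ∈ simplexΔ d, ∀ v ≠ 0, 0 < fderiv ℝ (gradv d g) x v ⬝ᵥ v := fun x hx v hv =>
    fderiv_gradv_pos (hdiff.differentiableAt (hs.mem_nhds hx)) (hpos x hx) hv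
  have hinj := injOn_of_fderiv_pos hs (convex_simplexΔ d) hdiff hder
  have hsurj := exists_gradv_eq hs (nonempty_simplexΔ d) (isBounded_simplexΔ d)
    (hg.differentiableOn (by simp)) hbd
  choose H hHmem hH using hsurj
  have hleft : Set.LeftInvOn H (gradv d g) (simplexΔ d) := fun x hx =>
    hinj (hHmem _) hx (hH _)
  refine ⟨hinj, Set.eq_univ_of_forall fun y => ⟨H y, hHmem y, hH y⟩, hsmooth, H,
    contDiff_iff_contDiffAt.2 fun y => ?_, hleft, fun y => ⟨hHmem y, hH y⟩⟩
  have hx := hHmem y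
  rw [← hH y]
  refine contDiffAt_of_leftInvOn hs (by simp) hx (hsmooth.contDiffAt (hs.mem_nhds hx)) ?_ hleft
  refine (injective_iff_map_eq_zero _).2 fun v hv => ?_
  by_contra hv0
  simpa [hv] using hder _ hx v hv0
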